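/- Let K be a nonempty finite type and let μ be the product measure on K → ℝ whose coordinates are i.i.d. standard Gaussians (gaussianReal 0 1). For an increasing set A ⊆ (K → Bool), x ∈ K, and h ∈ ℝ, let Piv_x(A) := {ω : K → Bool | (update ω x true) ∈ A ∧ (update ω x false) ∉ A}. Then ∫_{A^h} φ x dμ(φ) = ((2π)^{-1/2}·exp(−h²/2)) · μ({φ | (fun y => decide (h ≤ φ y)) ∈ Piv_x(A)}). (Margulis–Russo formula in the independent case, Remark 3.3(2).) -/

import Mathlib

open MeasureTheory Real ProbabilityTheory

/-- The level-set event `A^h = {φ | (1{h ≤ φ y})_y ∈ A}`. -/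
def levSet {K : Type} (A : Set (K → Bool)) (h : ℝ) : Set (K → ℝ) :=
  {φ | (fun y => decide (h ≤ φ y)) ∈ A}

/-- The truncated first moment `∫_{[h, ∞)} t dγ` of a standard Gaussian is its density at `h`. -/
lemma setIntegral_Ici_id_gaussianReal (h : ℝ) :
    ∫ t in Set.Ici h, t ∂(gaussianReal 0 1) = (2 * π) ^ (-(1 : ℝ) / 2) * Real.exp (-h ^ 2 / 2) := by
  have hc : (√(2 * π))⁻¹ = (2 * π) ^ (-(1 : ℝ) / 2) := by
    rw [Real.sqrt_eq_rpow, ← Real.rpow_neg (by positivity)]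
    norm_num
  have hderiv : ∀ t ∈ Set.Ici h,
      HasDerivAt (fun t : ℝ => -Real.exp (-t ^ 2 / 2)) (Real.exp (-t ^ 2 / 2) * t) t := by
    intro t _
    have h1 : HasDerivAt (fun t : ℝ => -t ^ 2 / 2) (-t) t := by
      have := ((hasDerivAt_pow 2 t).neg).div_const 2
      convert! this using 1
      ring
    convert! h1.exp.neg using 1
    ring
  have hint : Integrable (fun t : ℝ => Real.exp (-t ^ 2 / 2) * t) := by
    convert! integrable_mul_exp_neg_mul_sq (b := 1 / 2) (by norm_num) using 2 with t
    rw [mul_comm]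
    ring_nf
  have htend : Filter.Tendsto (fun t : ℝ => -Real.exp (-t ^ 2 / 2)) Filter.atTop (nhds 0) := by
    rw [← neg_zero]
    refine (Real.tendsto_exp_atBot.comp ?_).neg
    have := ((Filter.tendsto_pow_atTop (α := ℝ) two_ne_zero).atTop_div_const
      (two_pos : (0 : ℝ) < 2))
    refine (Filter.tendsto_neg_atTop_atBot.comp this).congr fun t => ?_
    simp [neg_div]
  have key := integral_Ioi_of_hasDerivAt_of_tendsto' hderiv hint.integrableOn htend
  rw [← integral_indicator measurableSet_Ici,
    integral_gaussianReal_eq_integral_smul one_ne_zero]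
  have heq : (fun t => gaussianPDFReal 0 1 t • (Set.Ici h).indicator (fun t => t) t) =
      (Set.Ici h).indicator
        (fun t => (2 * π) ^ (-(1 : ℝ) / 2) * (Real.exp (-t ^ 2 / 2) * t)) := by
    ext t
    by_cases ht : t ∈ Set.Ici h <;> simp [ht, gaussianPDFReal, ← hc, mul_assoc]
  rw [heq, integral_indicator measurableSet_Ici, integral_Ici_eq_integral_Ioi,
    integral_const_mul, key]
  simp

/-- Under a product measure, an event that does not depend on the coordinate `x` is independent
of any function of that coordinate. -/
lemma setIntegral_pi_of_update_invariant {K : Type*} [Fintype K] [DecidableEq K]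
    (γ : Measure ℝ) [IsProbabilityMeasure γ] (x : K) {S : Set (K → ℝ)} (hS : MeasurableSet S)
    (hinv : ∀ φ t, Function.update φ x t ∈ S ↔ φ ∈ S) {g : ℝ → ℝ} (hg : Measurable g) :
    ∫ φ in S, g (φ x) ∂(Measure.pi fun _ : K => γ) =
      (∫ t, g t ∂γ) * (Measure.pi fun _ : K => γ).real S := by
  set μ := Measure.pi fun _ : K => γ
  have hind : iIndepFun (fun i (φ : K → ℝ) => φ i) μ :=
    iIndepFun_pi (X := fun _ => id) fun _ => aemeasurable_id
  have hpair := hind.indepFun_finset {x} {x}ᶜ disjoint_compl_right fun i => measurable_pi_apply i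
  let e : (({x}ᶜ : Finset K) → ℝ) → K → ℝ := fun ψ i =>
    if hi : i ∈ ({x}ᶜ : Finset K) then ψ ⟨i, hi⟩ else 0
  have he : Measurable e := by
    refine measurable_pi_lambda _ fun i => ?_
    by_cases hi : i ∈ ({x}ᶜ : Finset K)
    · simpa only [e, hi, dite_true] using measurable_pi_apply _
    · simp only [e, hi, dite_false, measurable_const]
  have heS : ∀ φ : K → ℝ, e (fun i => φ i) ∈ S ↔ φ ∈ S := by
    intro φ
    rw [← hinv φ 0]
    convert Iff.rfl using 2
    ext i
    by_cases hi : i = x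
    · subst hi; simp [e]
    · simp [e, hi]
  have hF : Measurable fun ψ => S.indicator (fun _ => (1 : ℝ)) (e ψ) :=
    (measurable_const.indicator hS).comp he
  have hcomp := hpair.comp
    (φ := fun ψ : ({x} : Finset K) → ℝ => g (ψ ⟨x, Finset.mem_singleton_self x⟩))
    (ψ := fun ψ => S.indicator (fun _ => (1 : ℝ)) (e ψ))
    (hg.comp (measurable_pi_apply _)) hF
  have hmul := hcomp.integral_fun_mul_eq_mul_integral
    (hg.comp (measurable_pi_apply x)).aestronglyMeasurable
    (hF.comp (by fun_prop)).aestronglyMeasurable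
  have hone : ∀ φ : K → ℝ, S.indicator (fun _ => (1 : ℝ)) (e fun i => φ i) =
      S.indicator (fun _ => (1 : ℝ)) φ := fun φ => by
    by_cases hφ : φ ∈ S
    · rw [Set.indicator_of_mem hφ, Set.indicator_of_mem ((heS φ).2 hφ)]
    · rw [Set.indicator_of_notMem hφ, Set.indicator_of_notMem (mt (heS φ).1 hφ)]
  simp only [Function.comp_def, hone] at hmul
  rw [← integral_indicator hS]
  convert! hmul using 1
  · congr with φ
    by_cases hφ : φ ∈ S <;> simp [hφ]
  · congr 1
    · rw [← (measurePreserving_eval (fun _ : K => γ) x).map_eq, integral_map]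
      · exact (measurable_pi_apply x).aemeasurable
      · exact hg.aestronglyMeasurable
    · simp [integral_indicator hS]

lemma measurableSet_levSet {K : Type} [Fintype K] (A : Set (K → Bool)) (h : ℝ) :
    MeasurableSet (levSet A h) := by
  have hm : Measurable fun (φ : K → ℝ) y => decide (h ≤ φ y) :=
    measurable_pi_lambda _ fun y => measurable_to_bool <| by
      simpa [Set.preimage] using measurableSet_le measurable_const (measurable_pi_apply y)
  exact hm (Set.toFinite A).measurableSet

lemma decide_le_update {K : Type} [DecidableEq K] (φ : K → ℝ) (x : K) (t h : ℝ) :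
    (fun y => decide (h ≤ Function.update φ x t y)) =
      Function.update (fun y => decide (h ≤ φ y)) x (decide (h ≤ t)) := by
  ext y
  by_cases hy : y = x
  · subst hy; simp
  · simp [hy]

/-- **Margulis–Russo formula in the independent case** (Remark 3.3(2)): for i.i.d.
standard Gaussians and an increasing event `A`,
`∫_{A^h} φ x dμ = (2π)^{-1/2} e^{-h²/2} · μ(Piv_x(A)^h)`. -/
theorem margulis_russo_independent
    (K : Type) [Fintype K] [Nonempty K] [DecidableEq K]
    (μ : Measure (K → ℝ))
    (hμ : μ = Measure.pi fun _ : K => gaussianReal 0 1)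
    (A : Set (K → Bool))
    (hA : ∀ ω ω' : K → Bool, ω ∈ A → (∀ y, ω y ≤ ω' y) → ω' ∈ A)
    (x : K) (h : ℝ) :
    (∫ φ in levSet A h, φ x ∂μ)
      = ((2 * π) ^ (-(1 : ℝ) / 2) * Real.exp (-h ^ 2 / 2))
        * (μ (levSet {ω : K → Bool |
            Function.update ω x true ∈ A ∧ Function.update ω x false ∉ A} h)).toReal := by
  subst hμ
  set γ := gaussianReal 0 1
  set Off : Set (K → ℝ) := levSet {ω | Function.update ω x false ∈ A} h with hOff
  set Piv : Set (K → ℝ) := levSet {ω : K → Bool |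
    Function.update ω x true ∈ A ∧ Function.update ω x false ∉ A} h with hPiv
  have hOffm : MeasurableSet Off := measurableSet_levSet _ h
  have hPivm : MeasurableSet Piv := measurableSet_levSet _ h
  have hOffinv : ∀ φ t, Function.update φ x t ∈ Off ↔ φ ∈ Off := fun φ t => by
    simp [hOff, levSet, decide_le_update]
  have hPivinv : ∀ φ t, Function.update φ x t ∈ Piv ↔ φ ∈ Piv := fun φ t => by
    simp [hPiv, levSet, decide_le_update]
  have hint : Integrable (fun φ : K → ℝ => φ x) (Measure.pi fun _ : K => γ) :=
    (measurePreserving_eval (fun _ : K => γ) x).integrable_comp_of_integrable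
      (memLp_one_iff_integrable.1 (memLp_id_gaussianReal 1))
  have hEm : MeasurableSet {φ : K → ℝ | h ≤ φ x} :=
    measurableSet_le measurable_const (measurable_pi_apply x)
  have hsplit : levSet A h = Off ∪ Piv ∩ {φ | h ≤ φ x} := by
    ext φ
    have hmono : Function.update (fun y => decide (h ≤ φ y)) x false ∈ A →
        Function.update (fun y => decide (h ≤ φ y)) x true ∈ A := fun hω =>
      hA _ _ hω fun y => by by_cases hy : y = x <;> simp [hy]
    have hself := Function.update_eq_self x fun y => decide (h ≤ φ y)
    simp only [hOff, hPiv, levSet, Set.mem_union, Set.mem_inter_iff, Set.mem_ofPred_eq]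
    by_cases hx : h ≤ φ x
    · simp only [hx, decide_true] at hself
      rw [hself] at hmono ⊢
      tauto
    · simp only [hx, decide_false] at hself
      rw [hself]
      tauto
  have hdisj : Disjoint Off (Piv ∩ {φ | h ≤ φ x}) :=
    Set.disjoint_left.2 fun φ h1 h2 => h2.1.2 h1
  rw [hsplit, setIntegral_union hdisj (hPivm.inter hEm) hint.integrableOn hint.integrableOn,
    setIntegral_pi_of_update_invariant γ x hOffm hOffinv (g := fun t => t) measurable_id,
    integral_id_gaussianReal, zero_mul, zero_add, ← setIntegral_indicator hEm]
  have hind : ∀ φ : K → ℝ, {φ : K → ℝ | h ≤ φ x}.indicator (fun φ => φ x) φ =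
      (Set.Ici h).indicator (fun t => t) (φ x) := fun φ => rfl
  simp only [hind]
  rw [setIntegral_pi_of_update_invariant γ x hPivm hPivinv
      (g := (Set.Ici h).indicator fun t => t) (measurable_id.indicator measurableSet_Ici), integral_indicator measurableSet_Ici,
    setIntegral_Ici_id_gaussianReal]
  rfl
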